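/- Let a_n be the coefficient of q^n in ∏_{m=1}^∞ (1 - q^m)^4. Let f : ℕ → ℤ be the multiplicative arithmetic function determined on prime powers p^r (r ≥ 1) by: f(p^r) = (-1)^{r/2} p^{r/2} if p ≡ 5 (mod 6) and r is even; if p ≡ 1 (mod 6), then, writing (x, y) for the unique pair of positive integers with p = x^2 + 3y^2, f(p^r) is the integer whose image in ℂ equals δ·[(x + √3·i·y)^{r+1} − (x − √3·i·y)^{r+1}]/(2√3·i·y), where δ = −1 if r is odd and x ≢ 1 (mod 3), and δ = 1 otherwise; and f(p^r) = 0 in all remaining cases. Then a_n = f(6n + 1) for all n ≥ 0. -/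

import Mathlib

/-- A prime `p ≡ 1 (mod 3)` admits a square root of `-3` modulo `p`. -/
theorem exists_sq_eq_neg_three_zmod {p : ℕ} [Fact p.Prime] (h : p % 3 = 1) :
    ∃ c : ZMod p, c ^ 2 = -3 := by
  have hd : 3 ∣ Fintype.card (ZMod p)ˣ := by
    rw [ZMod.card_units]; omega
  have : Fact (Nat.Prime 3) := ⟨Nat.prime_three⟩
  obtain ⟨w, hw⟩ := exists_prime_orderOf_dvd_card 3 hd
  have h3 : (w : ZMod p) ^ 3 = 1 := by
    rw [← Units.val_pow_eq_pow_val, ← hw, pow_orderOf_eq_one, Units.val_one]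
  have h1 : (w : ZMod p) - 1 ≠ 0 := by
    intro h0
    have : w = 1 := Units.ext (by simpa using sub_eq_zero.mp h0)
    rw [this, orderOf_one] at hw
    omega
  have h2 : (w : ZMod p) ^ 2 + w + 1 = 0 := by
    apply (mul_eq_zero.mp (?_ : ((w : ZMod p) - 1) * _ = 0)).resolve_left h1
    linear_combination h3
  exact ⟨2 * w + 1, by linear_combination 4 * h2⟩

/-- A prime `p ≡ 2 (mod 3)` other than `2` is inert for the form `x² + 3y²`. -/
theorem dvd_of_dvd_sq_add_three_mul_sq {p : ℕ} (hp : p.Prime) (h : p % 6 = 5) {x y : ℤ}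
    (hd : (p : ℤ) ∣ x ^ 2 + 3 * y ^ 2) : (p : ℤ) ∣ x ∧ (p : ℤ) ∣ y := by
  have : Fact p.Prime := ⟨hp⟩
  have hxy : (x : ZMod p) ^ 2 + 3 * (y : ZMod p) ^ 2 = 0 := by
    have := (ZMod.intCast_zmod_eq_zero_iff_dvd (x ^ 2 + 3 * y ^ 2) p).mpr hd
    push_cast at this
    exact this
  have h2 : (2 : ZMod p) ≠ 0 := by
    intro h0
    have : p ∣ 2 := (ZMod.natCast_eq_zero_iff 2 p).mp (by exact_mod_cast h0)
    have := Nat.le_of_dvd (by norm_num) this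
    omega
  have hy : (y : ZMod p) = 0 := by
    by_contra hy
    obtain ⟨s, hs⟩ : ∃ s : ZMod p, s ^ 2 = -3 := by
      refine ⟨x / y, ?_⟩
      field_simp
      linear_combination hxy
    obtain ⟨w, hw⟩ : ∃ w : ZMod p, 2 * w = s - 1 := ⟨(s - 1) / 2, by field_simp⟩
    have hq : w ^ 2 + w + 1 = 0 := by
      have : (2 * 2) * (w ^ 2 + w + 1) = 0 := by
        linear_combination (2 * w + s + 1) * hw + hs
      exact (mul_eq_zero.mp this).resolve_left (mul_ne_zero h2 h2)
    have hw3 : w ^ 3 = 1 := by linear_combination (w - 1) * hq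
    have hw0 : w ≠ 0 := by rintro rfl; simp at hq
    have hpw : w ^ (p - 1) = 1 := ZMod.pow_card_sub_one_eq_one hw0
    have hw1 : w = 1 := by
      have : p - 1 = 3 * ((p - 1) / 3) + 1 := by omega
      rw [this, pow_succ, pow_mul, hw3, one_pow, one_mul] at hpw
      exact hpw
    rw [hw1] at hq
    have h3 : ((3 : ℕ) : ZMod p) = 0 := by push_cast; linear_combination hq
    have := Nat.le_of_dvd (by norm_num) ((ZMod.natCast_eq_zero_iff 3 p).mp h3)
    omega
  have hx : (x : ZMod p) = 0 := by
    rw [hy] at hxy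
    simpa using hxy
  exact ⟨(ZMod.intCast_zmod_eq_zero_iff_dvd _ _).mp hx,
    (ZMod.intCast_zmod_eq_zero_iff_dvd _ _).mp hy⟩

/-- Thue's lemma. -/
theorem exists_small_eq_mul_zmod {p : ℕ} [Fact p.Prime] (c : ZMod p) :
    ∃ x y : ℤ, (x, y) ≠ (0, 0) ∧ x ^ 2 < p ∧ y ^ 2 < p ∧ (x : ZMod p) = c * y := by
  have hp : p.Prime := Fact.out
  set s := p.sqrt with hs
  have hlt : s * s < p := by
    refine lt_of_le_of_ne (Nat.sqrt_le p) fun h => ?_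
    exact hp.not_isSquare ⟨s, h.symm⟩
  have hgt : p < (s + 1) * (s + 1) := Nat.lt_succ_sqrt p
  obtain ⟨u, -, v, -, huv, he⟩ := Finset.exists_ne_map_eq_of_card_lt_of_maps_to
    (s := (Finset.univ : Finset (Fin (s + 1) × Fin (s + 1)))) (t := (Finset.univ : Finset (ZMod p)))
    (by simpa [ZMod.card] using hgt)
    (f := fun u => ((u.1 : ℕ) : ZMod p) - c * ((u.2 : ℕ) : ZMod p)) (fun _ _ => by simp)
  have bound : ∀ i j : Fin (s + 1), (((i : ℕ) : ℤ) - ((j : ℕ) : ℤ)) ^ 2 < p := by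
    intro i j
    have hi : ((i : ℕ) : ℤ) ≤ s := by exact_mod_cast Nat.lt_succ_iff.mp i.2
    have hj : ((j : ℕ) : ℤ) ≤ s := by exact_mod_cast Nat.lt_succ_iff.mp j.2
    have hlt' : (s : ℤ) * s < p := by exact_mod_cast hlt
    have := abs_le.mpr (⟨by omega, by omega⟩ : -(s : ℤ) ≤ ((i : ℕ) : ℤ) - ((j : ℕ) : ℤ) ∧
      ((i : ℕ) : ℤ) - ((j : ℕ) : ℤ) ≤ s)
    have := sq_le_sq' (abs_le.mp this).1 (abs_le.mp this).2
    nlinarith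
  refine ⟨(u.1 : ℕ) - (v.1 : ℕ), (u.2 : ℕ) - (v.2 : ℕ), ?_, bound _ _, bound _ _, ?_⟩
  · intro h0
    rw [Prod.mk.injEq] at h0
    exact huv (Prod.ext (Fin.ext (by omega)) (Fin.ext (by omega)))
  · push_cast
    linear_combination he

theorem exists_prime_eq_sq_add_three_mul_sq {p : ℕ} (hp : p.Prime) (h : p % 6 = 1) :
    ∃ x y : ℕ, 0 < x ∧ 0 < y ∧ p = x ^ 2 + 3 * y ^ 2 := by
  have : Fact p.Prime := ⟨hp⟩
  obtain ⟨c, hc⟩ := exists_sq_eq_neg_three_zmod (p := p) (by omega)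
  obtain ⟨x, y, hne, hx, hy, hxy⟩ := exists_small_eq_mul_zmod c
  obtain ⟨k, hk⟩ : (p : ℤ) ∣ x ^ 2 + 3 * y ^ 2 := by
    rw [← ZMod.intCast_zmod_eq_zero_iff_dvd]
    push_cast
    rw [hxy]
    linear_combination (y : ZMod p) ^ 2 * hc
  have hp0 : (0 : ℤ) < p := by exact_mod_cast hp.pos
  have hpos : 0 < x ^ 2 + 3 * y ^ 2 := by
    by_cases hx0 : x = 0
    · have : y ≠ 0 := fun hy0 => hne (by rw [hx0, hy0])
      positivity
    · positivity
  have hk0 : 0 < k := by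
    by_contra hk0
    nlinarith
  have hk4 : k < 4 := by
    by_contra hk4
    nlinarith
  obtain ⟨X, Y, hXY⟩ : ∃ X Y : ℤ, (p : ℤ) = X ^ 2 + 3 * Y ^ 2 := by
    have hp6 : (p : ℤ) % 6 = 1 := by omega
    interval_cases k
    · exact ⟨x, y, by linarith⟩
    · exfalso
      obtain ⟨m, rfl | rfl⟩ := Int.even_or_odd' x <;>
        obtain ⟨n, rfl | rfl⟩ := Int.even_or_odd' y <;>
        ring_nf at hk <;> omega
    · obtain ⟨z, rfl⟩ : (3 : ℤ) ∣ x :=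
        Int.prime_three.dvd_of_dvd_pow (n := 2) ⟨p - y ^ 2, by linarith⟩
      exact ⟨y, z, by linarith⟩
  have hX0 : X ≠ 0 := by
    rintro rfl
    omega
  have hY0 : Y ≠ 0 := by
    rintro rfl
    apply hp.not_isSquare
    refine ⟨X.natAbs, ?_⟩
    zify
    rw [abs_mul_abs_self]
    linarith
  refine ⟨X.natAbs, Y.natAbs, Int.natAbs_pos.mpr hX0, Int.natAbs_pos.mpr hY0, ?_⟩
  zify
  rw [sq_abs, sq_abs, hXY]

theorem prime_eq_sq_add_three_mul_sq_unique {p : ℕ} (hp : p.Prime) {x y u v : ℕ}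
    (hx : 0 < x) (hy : 0 < y) (hu : 0 < u) (hv : 0 < v)
    (h : p = x ^ 2 + 3 * y ^ 2) (h' : p = u ^ 2 + 3 * v ^ 2) : u = x ∧ v = y := by
  have hpp : Prime (p : ℤ) := Nat.prime_iff_prime_int.mp hp
  have hp0 : (0 : ℤ) < p := by exact_mod_cast hp.pos
  zify at h h' hx hy hu hv
  have hprod : (p : ℤ) ∣ (x * v - y * u) * (x * v + y * u) :=
    ⟨v ^ 2 - y ^ 2, by linear_combination (-(v : ℤ) ^ 2) * h + y ^ 2 * h'⟩
  have hzero : (x * v - y * u : ℤ) = 0 := by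
    rcases hpp.dvd_or_dvd hprod with hd | hd
    · refine Int.eq_zero_of_abs_lt_dvd hd (abs_lt_of_sq_lt_sq ?_ hp0.le)
      have : (x * u + 3 * y * v : ℤ) ^ 2 + 3 * (x * v - y * u) ^ 2 = p ^ 2 := by
        rw [pow_two (p : ℤ)]; nth_rw 1 [h]; rw [h']; ring
      have : (0 : ℤ) < x * u + 3 * y * v := by positivity
      nlinarith [sq_nonneg (x * v - y * u : ℤ)]
    · exfalso
      have hpos : (0 : ℤ) < x * v + y * u := by positivity
      have hle := Int.le_of_dvd hpos hd
      have : (x * u - 3 * y * v : ℤ) ^ 2 + 3 * (x * v + y * u) ^ 2 = p ^ 2 := by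
        rw [pow_two (p : ℤ)]; nth_rw 1 [h]; rw [h']; ring
      nlinarith [sq_nonneg (x * u - 3 * y * v : ℤ)]
  have hvy : (v : ℤ) ^ 2 = y ^ 2 := by
    apply mul_left_cancel₀ hp0.ne'
    linear_combination (v : ℤ) ^ 2 * h - y ^ 2 * h' + (x * v + y * u) * hzero
  have hvy' : (v : ℤ) = y := by
    exact (pow_left_inj₀ hv.le hy.le two_ne_zero).mp hvy
  have hux : (u : ℤ) = x := by
    rw [hvy'] at hzero
    have : (x - u : ℤ) * y = 0 := by linear_combination hzero
    have := (mul_eq_zero.mp this).resolve_right hy.ne'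
    linarith
  exact ⟨by exact_mod_cast hux, by exact_mod_cast hvy'⟩

/-- The representations `N = x² + 3y²` with `x ≡ 1 (mod 3)`. -/
noncomputable def primaryReps (N : ℕ) : Finset (ℤ × ℤ) :=
  (Finset.Icc (-(N : ℤ)) N ×ˢ Finset.Icc (-(N : ℤ)) N).filter
    fun z => z.1 ^ 2 + 3 * z.2 ^ 2 = N ∧ z.1 % 3 = 1

theorem mem_primaryReps {N : ℕ} {z : ℤ × ℤ} :
    z ∈ primaryReps N ↔ z.1 ^ 2 + 3 * z.2 ^ 2 = N ∧ z.1 % 3 = 1 := by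
  simp only [primaryReps, Finset.mem_filter, Finset.mem_product, Finset.mem_Icc,
    and_iff_right_iff_imp]
  rintro ⟨h, -⟩
  have hN : (N : ℤ) ≤ N ^ 2 := by exact_mod_cast Nat.le_self_pow two_ne_zero N
  exact ⟨abs_le_of_sq_le_sq' (by nlinarith [sq_nonneg z.2]) (by positivity),
    abs_le_of_sq_le_sq' (by nlinarith [sq_nonneg z.1]) (by positivity)⟩

/-- The `N`-th coefficient of the theta series attached to the Hecke character modulo `2√-3`. -/
noncomputable def heckeCoeff (N : ℕ) : ℤ := ∑ z ∈ primaryReps N, z.1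

theorem heckeCoeff_one : heckeCoeff 1 = 1 := by
  have : primaryReps 1 = {(1, 0)} := by decide +kernel
  simp [heckeCoeff, this]

theorem sum_snd_primaryReps (N : ℕ) : ∑ z ∈ primaryReps N, z.2 = 0 := by
  have : ∑ z ∈ primaryReps N, z.2 = ∑ z ∈ primaryReps N, -z.2 := by
    refine Finset.sum_nbij' (fun z => (z.1, -z.2)) (fun z => (z.1, -z.2)) ?_ ?_ ?_ ?_ ?_ <;>
      simp [mem_primaryReps]
  rw [Finset.sum_neg_distrib] at this
  linarith

section Split

variable {p : ℕ} {a b : ℤ}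

theorem primaryReps_prime_mul (hp : p.Prime) (hab : (p : ℤ) = a ^ 2 + 3 * b ^ 2) (ha : a % 3 = 1)
    (N : ℕ) : primaryReps (p * N) =
      (primaryReps N).image (fun z => (a * z.1 - 3 * b * z.2, a * z.2 + b * z.1)) ∪
      (primaryReps N).image (fun z => (a * z.1 + 3 * b * z.2, a * z.2 - b * z.1)) := by
  have hpp : Prime (p : ℤ) := Nat.prime_iff_prime_int.mp hp
  have hp0 : (p : ℤ) ≠ 0 := by exact_mod_cast hp.ne_zero
  obtain ⟨k, rfl⟩ : ∃ k, a = 3 * k + 1 := ⟨a / 3, by omega⟩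
  set a := 3 * k + 1 with hak
  have key : ∀ b : ℤ, (p : ℤ) = a ^ 2 + 3 * b ^ 2 → ∀ X Y : ℤ, X ^ 2 + 3 * Y ^ 2 = p * N →
      X % 3 = 1 → (p : ℤ) ∣ a * Y - b * X →
      ∃ z ∈ primaryReps N, (a * z.1 - 3 * b * z.2, a * z.2 + b * z.1) = (X, Y) := by
    rintro b hab X Y hXY hX ⟨y, hy⟩
    obtain ⟨x, hx⟩ : (p : ℤ) ∣ a * X + 3 * b * Y := by
      apply hpp.dvd_of_dvd_pow (n := 2)
      refine ⟨p * N - 3 * p * y ^ 2, ?_⟩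
      linear_combination (X ^ 2 + 3 * Y ^ 2) * (-hab) + p * hXY - 3 * (a * Y - b * X + p * y) * hy
    have e1 : a * x - 3 * b * y = X := by
      apply mul_left_cancel₀ hp0
      linear_combination X * (-hab) - a * hx + 3 * b * hy
    have e2 : a * y + b * x = Y := by
      apply mul_left_cancel₀ hp0
      linear_combination Y * (-hab) - a * hy - b * hx
    refine ⟨(x, y), mem_primaryReps.mpr ⟨?_, ?_⟩, by simp only [e1, e2]⟩
    · apply mul_left_cancel₀ hp0
      rw [← hXY, ← e1, ← e2, hab]
      ring
    · have : X = x + 3 * (k * x - b * y) := by rw [← e1, hak]; ring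
      simp only
      omega
  have maps : ∀ b : ℤ, (p : ℤ) = a ^ 2 + 3 * b ^ 2 → ∀ z ∈ primaryReps N,
      (a * z.1 - 3 * b * z.2, a * z.2 + b * z.1) ∈ primaryReps (p * N) := by
    intro b hab z hz
    obtain ⟨h1, h2⟩ := mem_primaryReps.mp hz
    refine mem_primaryReps.mpr ⟨?_, ?_⟩
    · push_cast
      rw [← h1, hab]
      ring
    · have : a * z.1 - 3 * b * z.2 = z.1 + 3 * (k * z.1 - b * z.2) := by rw [hak]; ring
      simp only [this]
      omega
  ext ⟨X, Y⟩
  simp only [Finset.mem_union, Finset.mem_image]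
  constructor
  · intro h
    obtain ⟨h1, h2⟩ := mem_primaryReps.mp h
    push_cast at h1
    have hd : (p : ℤ) ∣ (a * Y - b * X) * (a * Y + b * X) :=
      ⟨Y ^ 2 - b ^ 2 * N, by linear_combination (-Y ^ 2) * hab - b ^ 2 * h1⟩
    rcases hpp.dvd_or_dvd hd with hd | hd
    · exact Or.inl (key b hab X Y h1 h2 hd)
    · right
      obtain ⟨z, hz, he⟩ := key (-b) (by rw [hab]; ring) X Y h1 h2
        (by rwa [neg_mul, sub_neg_eq_add])
      exact ⟨z, hz, by rw [← he]; ring_nf⟩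
  · rintro (⟨z, hz, he⟩ | ⟨z, hz, he⟩)
    · rw [← he]
      exact maps b hab z hz
    · rw [← he]
      convert maps (-b) (by rw [hab]; ring) z hz using 2 <;> ring

theorem injective_mul_rep (hp : p ≠ 0) (hab : (p : ℤ) = a ^ 2 + 3 * b ^ 2) :
    Function.Injective (fun z : ℤ × ℤ => (a * z.1 - 3 * b * z.2, a * z.2 + b * z.1)) := by
  have hp0 : (p : ℤ) ≠ 0 := by exact_mod_cast hp
  rintro ⟨x, y⟩ ⟨u, v⟩ h
  simp only [Prod.mk.injEq] at h ⊢
  constructor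
  · apply mul_left_cancel₀ hp0
    linear_combination (x - u) * hab + a * h.1 + 3 * b * h.2
  · apply mul_left_cancel₀ hp0
    linear_combination (y - v) * hab + a * h.2 - b * h.1

theorem heckeCoeff_prime_mul_add_sum_inter (hp : p.Prime) (hab : (p : ℤ) = a ^ 2 + 3 * b ^ 2)
    (ha : a % 3 = 1) (N : ℕ) : heckeCoeff (p * N) +
      ∑ z ∈ (primaryReps N).image (fun z => (a * z.1 - 3 * b * z.2, a * z.2 + b * z.1)) ∩
      (primaryReps N).image (fun z => (a * z.1 + 3 * b * z.2, a * z.2 - b * z.1)), z.1 =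
      2 * a * heckeCoeff N := by
  have hinj := injective_mul_rep (a := a) (b := b) hp.ne_zero hab
  have hinj' : Function.Injective
      (fun z : ℤ × ℤ => (a * z.1 + 3 * b * z.2, a * z.2 - b * z.1)) := by
    convert injective_mul_rep (a := a) (b := -b) hp.ne_zero (by rw [hab]; ring) using 3 <;> ring
  rw [heckeCoeff, primaryReps_prime_mul hp hab ha, Finset.sum_union_inter,
    Finset.sum_image hinj.injOn, Finset.sum_image hinj'.injOn, ← Finset.sum_add_distrib,
    heckeCoeff, Finset.mul_sum]
  exact Finset.sum_congr rfl fun z _ => by ring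

theorem mem_image_inter_image (hp : p.Prime) (hp6 : p % 6 = 1) (hab : (p : ℤ) = a ^ 2 + 3 * b ^ 2)
    (ha : a % 3 = 1) {N : ℕ} {w : ℤ × ℤ}
    (hw : w ∈ (primaryReps N).image (fun z => (a * z.1 - 3 * b * z.2, a * z.2 + b * z.1)) ∩
      (primaryReps N).image (fun z => (a * z.1 + 3 * b * z.2, a * z.2 - b * z.1))) :
    ∃ M, N = p * M ∧ ∃ z ∈ primaryReps M, (p * z.1, p * z.2) = w := by
  have hpp : Prime (p : ℤ) := Nat.prime_iff_prime_int.mp hp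
  have hp0 : (0 : ℤ) < p := by exact_mod_cast hp.pos
  simp only [Finset.mem_inter, Finset.mem_image] at hw
  obtain ⟨⟨⟨x, y⟩, hz, rfl⟩, ⟨u, v⟩, hz', he⟩ := hw
  simp only [Prod.mk.injEq] at he
  obtain ⟨h1, h2⟩ := mem_primaryReps.mp hz
  simp only at h1 h2 he
  have h2a : ¬ (p : ℤ) ∣ 2 * a := by
    intro hd
    rcases hpp.dvd_or_dvd hd with hd | hd
    · have := Int.le_of_dvd (by norm_num) hd
      have := hp.one_lt
      omega
    · have ha0 : a = 0 := by
        refine Int.eq_zero_of_abs_lt_dvd hd (abs_lt_of_sq_lt_sq ?_ hp0.le)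
        have h7 : (7 : ℤ) ≤ p := by have := hp.one_lt; omega
        nlinarith [sq_nonneg b]
      omega
  have d1 : (p : ℤ) ∣ a * x - 3 * b * y := by
    refine (hpp.dvd_or_dvd (a := 2 * a) ⟨x + u, ?_⟩).resolve_left h2a
    linear_combination (-x - u) * hab - a * he.1 + 3 * b * he.2
  have d2 : (p : ℤ) ∣ a * y + b * x := by
    refine (hpp.dvd_or_dvd (a := 2 * a) ⟨y + v, ?_⟩).resolve_left h2a
    linear_combination (-y - v) * hab - a * he.2 - b * he.1
  obtain ⟨s, hs⟩ := d1
  obtain ⟨t, ht⟩ := d2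
  have hN : (N : ℤ) = p * (s ^ 2 + 3 * t ^ 2) := by
    apply mul_left_cancel₀ hp0.ne'
    rw [← h1]
    linear_combination (x ^ 2 + 3 * y ^ 2) * hab + (a * x - 3 * b * y + p * s) * hs +
      3 * (a * y + b * x + p * t) * ht
  refine ⟨(s ^ 2 + 3 * t ^ 2).toNat, ?_, (s, t), ?_, by simp only [hs, ht]⟩
  · zify
    rw [Int.toNat_of_nonneg (by positivity), hN]
  · refine mem_primaryReps.mpr ⟨(Int.toNat_of_nonneg (by positivity)).symm, ?_⟩
    obtain ⟨k, rfl⟩ : ∃ k, a = 3 * k + 1 := ⟨a / 3, by omega⟩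
    obtain ⟨j, hj⟩ : ∃ j : ℤ, (p : ℤ) = 6 * j + 1 := ⟨p / 6, by omega⟩
    have : x + 3 * (k * x - b * y) = s + 3 * (2 * (j * s)) := by
      rw [hj] at hs
      linear_combination hs
    simp only
    omega

theorem heckeCoeff_prime_mul_of_not_dvd (hp : p.Prime) (hp6 : p % 6 = 1)
    (hab : (p : ℤ) = a ^ 2 + 3 * b ^ 2) (ha : a % 3 = 1) {N : ℕ} (hN : ¬ p ∣ N) :
    heckeCoeff (p * N) = 2 * a * heckeCoeff N := by
  rw [← heckeCoeff_prime_mul_add_sum_inter hp hab ha N, Finset.sum_eq_zero, add_zero]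
  intro w hw
  obtain ⟨M, hM, -⟩ := mem_image_inter_image hp hp6 hab ha hw
  exact absurd ⟨M, hM⟩ hN

theorem heckeCoeff_prime_mul_prime_mul (hp : p.Prime) (hp6 : p % 6 = 1)
    (hab : (p : ℤ) = a ^ 2 + 3 * b ^ 2) (ha : a % 3 = 1) (N : ℕ) :
    heckeCoeff (p * (p * N)) = 2 * a * heckeCoeff (p * N) - p * heckeCoeff N := by
  have hp0 : (p : ℤ) ≠ 0 := by exact_mod_cast hp.ne_zero
  rw [← heckeCoeff_prime_mul_add_sum_inter hp hab ha (p * N), eq_sub_iff_add_eq, add_right_inj,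
    heckeCoeff, Finset.mul_sum]
  refine Finset.sum_nbij (fun z => (p * z.1, p * z.2)) ?_ ?_ ?_ fun _ _ => rfl
  · intro z hz
    rw [primaryReps_prime_mul hp hab ha, Finset.mem_inter, Finset.mem_image, Finset.mem_image]
    constructor
    · refine ⟨_, Finset.mem_union_right _ (Finset.mem_image_of_mem _ hz), ?_⟩
      simp only [Prod.mk.injEq, hab]
      constructor <;> ring
    · refine ⟨_, Finset.mem_union_left _ (Finset.mem_image_of_mem _ hz), ?_⟩
      simp only [Prod.mk.injEq, hab]
      constructor <;> ring
  · rintro ⟨x, y⟩ - ⟨u, v⟩ - h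
    simpa [hp.ne_zero] using h
  · intro w hw
    obtain ⟨M, hM, z, hz, he⟩ := mem_image_inter_image hp hp6 hab ha hw
    obtain rfl := Nat.eq_of_mul_eq_mul_left hp.pos hM
    exact ⟨z, hz, he⟩

end Split

section Inert

variable {p : ℕ}

theorem heckeCoeff_inert_mul_of_not_dvd (hp : p.Prime) (hp6 : p % 6 = 5) {N : ℕ} (hN : ¬ p ∣ N) :
    heckeCoeff (p * N) = 0 := by
  have hp0 : (p : ℤ) ≠ 0 := by exact_mod_cast hp.ne_zero
  rw [heckeCoeff, Finset.sum_eq_zero]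
  intro z hz
  obtain ⟨h1, -⟩ := mem_primaryReps.mp hz
  push_cast at h1
  obtain ⟨⟨x, hx⟩, y, hy⟩ := dvd_of_dvd_sq_add_three_mul_sq hp hp6 ⟨_, h1⟩
  refine absurd (Int.natCast_dvd_natCast.mp ⟨x ^ 2 + 3 * y ^ 2, ?_⟩) hN
  apply mul_left_cancel₀ hp0
  rw [← h1, hx, hy]
  ring

theorem heckeCoeff_inert_mul_inert_mul (hp : p.Prime) (hp6 : p % 6 = 5) (N : ℕ) :
    heckeCoeff (p * (p * N)) = - p * heckeCoeff N := by
  have hp0 : (p : ℤ) ≠ 0 := by exact_mod_cast hp.ne_zero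
  obtain ⟨k, hk⟩ : ∃ k : ℤ, (p : ℤ) = 3 * k + 2 := ⟨p / 3, by omega⟩
  rw [heckeCoeff, heckeCoeff, Finset.mul_sum]
  symm
  have hmod : ∀ x : ℤ, -(p : ℤ) * x % 3 = x % 3 := by
    intro x
    have : -(p : ℤ) * x = x - 3 * ((k + 1) * x) := by rw [hk]; ring
    omega
  refine Finset.sum_nbij (fun z => (-p * z.1, -p * z.2)) ?_ ?_ ?_ fun _ _ => rfl
  · intro z hz
    obtain ⟨h1, h2⟩ := mem_primaryReps.mp hz
    refine mem_primaryReps.mpr ⟨?_, by rw [hmod, h2]⟩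
    push_cast
    rw [← h1]
    ring
  · rintro ⟨x, y⟩ - ⟨u, v⟩ - h
    simpa [hp.ne_zero] using h
  · rintro ⟨X, Y⟩ hw
    obtain ⟨h1, h2⟩ := mem_primaryReps.mp hw
    push_cast at h1
    obtain ⟨⟨x, hx⟩, y, hy⟩ := dvd_of_dvd_sq_add_three_mul_sq hp hp6 ⟨_, h1⟩
    simp only at hx hy h1 h2
    refine ⟨(-x, -y), mem_primaryReps.mpr ⟨?_, ?_⟩, by simp [hx, hy]⟩
    · apply mul_left_cancel₀ hp0
      apply mul_left_cancel₀ hp0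
      rw [← h1, hx, hy]
      ring
    · rw [← h2, hx, ← hmod (-x)]
      simp

end Inert

/-- A sequence satisfying a Hecke recursion along the powers of `p` is multiplicative there. -/
theorem eq_mul_of_hecke_recursion {F : ℕ → ℤ} {g : ℕ → ℤ} {p : ℕ} {t d : ℤ} {m : ℕ}
    (hF1 : F (p * m) = t * F m) (hF : ∀ N, F (p * (p * N)) = t * F (p * N) - d * F N)
    (hg0 : g 0 = 1) (hg1 : g 1 = t) (hg : ∀ r, g (r + 2) = t * g (r + 1) - d * g r) (r : ℕ) :
    F (p ^ r * m) = g r * F m := by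
  induction r using Nat.twoStepInduction with
  | zero => simp [hg0]
  | one => simp [hg1, hF1]
  | more r ih0 ih1 =>
    have e0 : p ^ (r + 2) * m = p * (p * (p ^ r * m)) := by ring
    have e1 : p ^ (r + 1) * m = p * (p ^ r * m) := by ring
    rw [e1] at ih1
    rw [e0, hF, ih1, ih0, hg]
    ring

section Values

variable {f : ℕ → ℤ} {p : ℕ}

theorem split_prime_pow_recursion (hf1 : f 1 = 1) {x y : ℕ} (hy : 0 < y)
    (hp : p = x ^ 2 + 3 * y ^ 2) (hx : x % 3 ≠ 0)
    (h : ∀ r, 1 ≤ r → (f (p ^ r) : ℂ) =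
        (if Odd r ∧ x % 3 ≠ 1 then (-1 : ℂ) else 1) *
          (((x : ℂ) + Real.sqrt 3 * Complex.I * y) ^ (r + 1) -
            ((x : ℂ) - Real.sqrt 3 * Complex.I * y) ^ (r + 1)) /
          (2 * Real.sqrt 3 * Complex.I * y)) :
    ∃ a : ℤ, a % 3 = 1 ∧ (p : ℤ) = a ^ 2 + 3 * (y : ℤ) ^ 2 ∧ f (p ^ 1) = 2 * a ∧
      ∀ r, f (p ^ (r + 2)) = 2 * a * f (p ^ (r + 1)) - p * f (p ^ r) := by
  obtain ⟨e, he, he3, heδ⟩ : ∃ e : ℤ, e ^ 2 = 1 ∧ (e * x) % 3 = 1 ∧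
      ∀ r : ℕ, (if Odd r ∧ x % 3 ≠ 1 then (-1 : ℂ) else 1) = (e : ℂ) ^ r := by
    by_cases h1 : x % 3 = 1
    · exact ⟨1, by norm_num, by omega, fun r => by simp [h1]⟩
    · refine ⟨-1, by norm_num, by omega, fun r => ?_⟩
      rcases Nat.even_or_odd r with hr | hr
      · simp [hr, hr.neg_one_pow]
      · simp [hr, h1, hr.neg_one_pow]
  set w : ℂ := Real.sqrt 3 * Complex.I * y with hw
  have hs3 : (Real.sqrt 3 : ℂ) ^ 2 = 3 := by
    exact_mod_cast congrArg (fun t : ℝ => (t : ℂ)) (Real.sq_sqrt (by norm_num : (0 : ℝ) ≤ 3))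
  have hw2 : w ^ 2 = -3 * y ^ 2 := by
    rw [hw, mul_pow, mul_pow, hs3, Complex.I_sq]
    ring
  have hw0 : w ≠ 0 := by
    intro h0
    rw [h0] at hw2
    have : (y : ℂ) ≠ 0 := by exact_mod_cast hy.ne'
    simp [this] at hw2
  have hpc : (p : ℂ) = x ^ 2 + 3 * y ^ 2 := by exact_mod_cast hp
  have hec : (e : ℂ) ^ 2 = 1 := by exact_mod_cast he
  have hval : ∀ r, (f (p ^ r) : ℂ) = (e : ℂ) ^ r * ((x + w) ^ (r + 1) - (x - w) ^ (r + 1)) /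
      (2 * w) := by
    intro r
    rcases Nat.eq_zero_or_pos r with rfl | hr
    · rw [pow_zero, hf1, eq_div_iff (by simpa using hw0)]
      push_cast
      ring
    · rw [h r hr, heδ, hw]
      ring_nf
  refine ⟨e * x, he3, ?_, ?_, fun r => ?_⟩
  · rw [mul_pow, he, one_mul]
    exact_mod_cast hp
  · have := hval 1
    rw [eq_div_iff (by simpa using hw0)] at this
    apply Int.cast_injective (α := ℂ)
    apply mul_right_cancel₀ (mul_ne_zero two_ne_zero hw0)
    rw [this]
    push_cast
    ring
  · apply Int.cast_injective (α := ℂ)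
    push_cast
    rw [hval, hval, hval]
    apply mul_right_cancel₀ (mul_ne_zero two_ne_zero hw0)
    rw [sub_mul, mul_assoc (2 * ((e : ℂ) * x)), mul_assoc (p : ℂ), div_mul_cancel₀,
      div_mul_cancel₀, div_mul_cancel₀, hpc]
    · have h1 : (x + w) ^ 2 = 2 * x * (x + w) - (x ^ 2 + 3 * y ^ 2) := by
        linear_combination hw2
      have h2 : (x - w) ^ 2 = 2 * x * (x - w) - (x ^ 2 + 3 * y ^ 2) := by
        linear_combination hw2
      have e1 : (x + w) ^ (r + 2 + 1) = (x + w) ^ 2 * (x + w) ^ (r + 1) := by ring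
      have e2 : (x - w) ^ (r + 2 + 1) = (x - w) ^ 2 * (x - w) ^ (r + 1) := by ring
      rw [e1, e2, h1, h2, pow_succ (x + w) (r + 1), pow_succ (x - w) (r + 1),
        pow_succ (e : ℂ) (r + 1), pow_succ (e : ℂ) r]
      linear_combination -(e : ℂ) ^ r * ((x ^ 2 + 3 * y ^ 2) *
        ((x + w) ^ (r + 1) - (x - w) ^ (r + 1))) * hec
    all_goals exact mul_ne_zero two_ne_zero hw0

theorem inert_prime_pow_recursion
    (hfa : ∀ r : ℕ, 1 ≤ r → Even r → f (p ^ r) = (-1) ^ (r / 2) * (p : ℤ) ^ (r / 2))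
    (hf0 : ∀ r : ℕ, 1 ≤ r → Odd r → f (p ^ r) = 0) (hf1 : f 1 = 1) (r : ℕ) :
    f (p ^ (r + 2)) = -p * f (p ^ r) := by
  rcases Nat.even_or_odd r with hr | hr
  · have : f (p ^ r) = (-1) ^ (r / 2) * (p : ℤ) ^ (r / 2) := by
      rcases Nat.eq_zero_or_pos r with rfl | h0
      · simpa using hf1
      · exact hfa r h0 hr
    rw [this, hfa _ (by omega) (hr.add even_two), Nat.add_div_right _ two_pos]
    ring
  · rw [hf0 r hr.pos hr, hf0 _ (by omega) (hr.add_even even_two), mul_zero]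

end Values

theorem eq_heckeCoeff (f : ℕ → ℤ)
    (hf1 : f 1 = 1)
    (hfmul : ∀ m n : ℕ, Nat.Coprime m n → f (m * n) = f m * f n)
    (hfa : ∀ p r : ℕ, p.Prime → 1 ≤ r → p % 6 = 5 → Even r →
      f (p ^ r) = (-1) ^ (r / 2) * (p : ℤ) ^ (r / 2))
    (hfb : ∀ p r x y : ℕ, p.Prime → 1 ≤ r → p % 6 = 1 → 0 < x → 0 < y →
      p = x ^ 2 + 3 * y ^ 2 →
      (f (p ^ r) : ℂ) =
        (if Odd r ∧ x % 3 ≠ 1 then (-1 : ℂ) else 1) *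
          (((x : ℂ) + Real.sqrt 3 * Complex.I * y) ^ (r + 1) -
            ((x : ℂ) - Real.sqrt 3 * Complex.I * y) ^ (r + 1)) /
          (2 * Real.sqrt 3 * Complex.I * y))
    (hf0 : ∀ p r : ℕ, p.Prime → 1 ≤ r → ¬(p % 6 = 1) → ¬(p % 6 = 5 ∧ Even r) →
      f (p ^ r) = 0) (N : ℕ) (hN : N.Coprime 6) : f N = heckeCoeff N := by
  have local_factor : ∀ p : ℕ, p.Prime → p.Coprime 6 → ∀ r m : ℕ, ¬ p ∣ m →
      heckeCoeff (p ^ r * m) = f (p ^ r) * heckeCoeff m := by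
    intro p hp hp6 r m hm
    have h2 : ¬ 2 ∣ p := fun h => by
      have := Nat.dvd_gcd h (by norm_num : 2 ∣ 6)
      rw [hp6] at this
      omega
    have h3 : ¬ 3 ∣ p := fun h => by
      have := Nat.dvd_gcd h (by norm_num : 3 ∣ 6)
      rw [hp6] at this
      omega
    obtain h1 | h5 : p % 6 = 1 ∨ p % 6 = 5 := by omega
    · obtain ⟨x, y, hx, hy, hxy⟩ := exists_prime_eq_sq_add_three_mul_sq hp h1
      have hx3 : x % 3 ≠ 0 := by
        intro h0
        obtain ⟨k, rfl⟩ := Nat.dvd_of_mod_eq_zero h0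
        exact h3 ⟨3 * k ^ 2 + y ^ 2, by rw [hxy]; ring⟩
      obtain ⟨a, ha, hab, hp1, hrec⟩ := split_prime_pow_recursion hf1 hy hxy hx3
        fun r hr => hfb p r x y hp hr h1 hx hy hxy
      exact eq_mul_of_hecke_recursion (g := fun r => f (p ^ r))
        (heckeCoeff_prime_mul_of_not_dvd hp h1 hab ha hm)
        (heckeCoeff_prime_mul_prime_mul hp h1 hab ha) (by simpa using hf1) hp1 hrec r
    · have hrec := inert_prime_pow_recursion (fun r hr he => hfa p r hp hr h5 he)
        (fun r hr ho => hf0 p r hp hr (by omega) (by grind)) hf1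
      refine eq_mul_of_hecke_recursion (g := fun r => f (p ^ r)) (t := 0) (d := p) ?_ ?_
        (by simpa using hf1) (hf0 p 1 hp le_rfl (by omega) (by simp)) ?_ r
      · rw [heckeCoeff_inert_mul_of_not_dvd hp h5 hm, zero_mul]
      · intro N
        rw [heckeCoeff_inert_mul_inert_mul hp h5]
        ring
      · intro r
        rw [hrec]
        ring
  induction N using Nat.strong_induction_on with
  | _ N ih =>
    obtain rfl | h1 := eq_or_ne N 1
    · rw [hf1, heckeCoeff_one]
    · have h0 : N ≠ 0 := by rintro rfl; simp at hN
      have hp := Nat.minFac_prime h1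
      have hp6 : N.minFac.Coprime 6 := hN.coprime_dvd_left (Nat.minFac_dvd N)
      obtain ⟨r, m, hm, hNm⟩ := Nat.exists_eq_pow_mul_and_not_dvd h0 N.minFac hp.ne_one
      have hr : r ≠ 0 := by
        rintro rfl
        apply hm
        rw [pow_zero, one_mul] at hNm
        rw [← hNm]
        exact Nat.minFac_dvd N
      generalize N.minFac = p at hp hp6 hm hNm
      subst hNm
      have hm0 : 0 < m := Nat.pos_of_ne_zero (right_ne_zero_of_mul h0)
      have hlt : m < p ^ r * m := lt_mul_of_one_lt_left hm0 (Nat.one_lt_pow hr hp.one_lt)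
      rw [local_factor p hp hp6 r m hm,
        hfmul _ _ (((Nat.Prime.coprime_iff_not_dvd hp).mpr hm).pow_left r),
        ih m hlt (hN.coprime_dvd_left (Dvd.intro_left _ rfl))]

section Jacobi

open PowerSeries

/-- The `q`-Pochhammer symbol `(q; q)_n` as a power series. -/
noncomputable def qPochhammer (n : ℕ) : ℤ⟦X⟧ := ∏ i ∈ Finset.range n, (1 - X ^ (i + 1))

theorem qPochhammer_succ (n : ℕ) : qPochhammer (n + 1) = qPochhammer n * (1 - X ^ (n + 1)) :=
  Finset.prod_range_succ _ _

/-- The inverse of `(q; q)_m`, extended by zero to negative `m`. -/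
noncomputable def qPochhammerInv (m : ℤ) : ℤ⟦X⟧ :=
  if 0 ≤ m then invOfUnit (qPochhammer m.toNat) 1 else 0

theorem qPochhammerInv_of_neg {m : ℤ} (h : m < 0) : qPochhammerInv m = 0 := if_neg h.not_ge

theorem qPochhammer_mul_inv (n : ℕ) : qPochhammer n * qPochhammerInv n = 1 := by
  rw [qPochhammerInv, if_pos (Int.natCast_nonneg n), Int.toNat_natCast]
  apply mul_invOfUnit
  simp [qPochhammer, map_prod]

theorem qPochhammerInv_natCast_sub_one (n : ℕ) :
    qPochhammerInv ((n : ℤ) - 1) = (1 - X ^ n) * qPochhammerInv n := by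
  rcases n with _ | n
  · simp [qPochhammerInv_of_neg]
  · have h1 := qPochhammer_mul_inv (n + 1)
    have h0 := qPochhammer_mul_inv n
    rw [qPochhammer_succ] at h1
    rw [Nat.cast_succ, add_sub_cancel_right]
    push_cast at h1
    linear_combination (1 - X ^ (n + 1)) * qPochhammerInv (n + 1) * h0 - qPochhammerInv n * h1

theorem X_pow_dvd_qPochhammer_sub {m M : ℕ} (h : m ≤ M) :
    (X : ℤ⟦X⟧) ^ (m + 1) ∣ qPochhammer M - qPochhammer m := by
  induction M, h using Nat.le_induction with
  | base => simp
  | succ M hM ih =>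
    have : qPochhammer (M + 1) - qPochhammer m =
        (qPochhammer M - qPochhammer m) - qPochhammer M * X ^ (M + 1) := by
      rw [qPochhammer_succ]; ring
    rw [this]
    exact dvd_sub ih (Dvd.dvd.mul_left (pow_dvd_pow _ (by omega)) _)

theorem X_pow_dvd_qPochhammer_mul_inv_sub_one {m M : ℕ} (h : m ≤ M) :
    (X : ℤ⟦X⟧) ^ (m + 1) ∣ qPochhammer M * qPochhammerInv m - 1 := by
  rw [← qPochhammer_mul_inv m, ← sub_mul]
  exact (X_pow_dvd_qPochhammer_sub h).mul_right _

/-- The triangular number `k (k - 1) / 2`. -/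
def triangular (k : ℤ) : ℕ := (k * (k - 1) / 2).toNat

theorem two_mul_triangular (k : ℤ) : 2 * (triangular k : ℤ) = k * (k - 1) := by
  have h : 0 ≤ k * (k - 1) := by
    rcases le_or_gt k 0 with h | h
    · nlinarith
    · exact mul_nonneg h.le (by omega)
  rw [triangular, Int.toNat_of_nonneg (by omega)]
  exact Int.mul_ediv_cancel' (by simpa [mul_comm] using (Int.even_mul_pred_self k).two_dvd)

/-- The coefficient of `z ^ k` in `∏_{0 ≤ i ≤ N} (1 - z q^i) ∏_{1 ≤ i ≤ N} (1 - z⁻¹ q^i)`. -/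
noncomputable def finiteThetaCoeff (N : ℕ) (k : ℤ) : ℤ⟦X⟧ :=
  ((k.negOnePow : ℤ) : ℤ⟦X⟧) * X ^ triangular k * qPochhammer (2 * N + 1) *
    qPochhammerInv (N + k) * qPochhammerInv (N + 1 - k)

theorem finiteThetaCoeff_eq_zero {N : ℕ} {k : ℤ} (h : k < -N ∨ N + 1 < k) :
    finiteThetaCoeff N k = 0 := by
  rcases h with h | h
  · rw [finiteThetaCoeff, qPochhammerInv_of_neg (m := N + k) (by omega), mul_zero, zero_mul]
  · rw [finiteThetaCoeff, qPochhammerInv_of_neg (m := N + 1 - k) (by omega), mul_zero]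

theorem finiteThetaCoeff_succ (N : ℕ) (k : ℤ) : finiteThetaCoeff (N + 1) k =
    (1 + X ^ (2 * N + 2)) * finiteThetaCoeff N k -
      X ^ (N + 1) * (finiteThetaCoeff N (k - 1) + finiteThetaCoeff N (k + 1)) := by
  have tk := two_mul_triangular k
  have tk1 := two_mul_triangular (k - 1)
  have tk2 := two_mul_triangular (k + 1)
  have s1 : (((k - 1).negOnePow : ℤ) : ℤ⟦X⟧) = -((k.negOnePow : ℤ) : ℤ⟦X⟧) := by
    simp [Int.negOnePow_sub]
  have s2 : (((k + 1).negOnePow : ℤ) : ℤ⟦X⟧) = -((k.negOnePow : ℤ) : ℤ⟦X⟧) := by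
    simp [Int.negOnePow_add]
  rcases lt_trichotomy (-(N : ℤ) - 1) k with h | h | h
  · rcases lt_trichotomy k (N + 2) with h' | h' | h'
    · obtain ⟨A, hA⟩ : ∃ A : ℕ, (A : ℤ) = N + k := ⟨(N + k).toNat, by omega⟩
      obtain ⟨B, hB⟩ : ∃ B : ℕ, (B : ℤ) = N + 1 - k := ⟨(N + 1 - k).toNat, by omega⟩
      have hAB : 2 * N + 1 = A + B := by omega
      have e1 : N + 1 + triangular (k - 1) = triangular k + (B + 1) := by
        zify; linarith
      have e2 : N + 1 + triangular (k + 1) = triangular k + (A + 1) := by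
        zify; linarith
      have a1 := qPochhammerInv_natCast_sub_one (A + 1)
      have a2 := qPochhammerInv_natCast_sub_one A
      have b1 := qPochhammerInv_natCast_sub_one (B + 1)
      have b2 := qPochhammerInv_natCast_sub_one B
      rw [Nat.cast_succ, add_sub_cancel_right] at a1 b1
      rw [a1] at a2
      rw [b1] at b2
      have g0 : finiteThetaCoeff (N + 1) k = ((k.negOnePow : ℤ) : ℤ⟦X⟧) * X ^ triangular k *
          (qPochhammer (A + B) * (1 - X ^ (A + B + 1)) * (1 - X ^ (A + B + 2))) *
          qPochhammerInv (A + 1) * qPochhammerInv (B + 1) := by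
        rw [finiteThetaCoeff, show 2 * (N + 1) + 1 = A + B + 1 + 1 by omega, qPochhammer_succ,
          qPochhammer_succ, hA, hB]
        push_cast
        ring_nf
      have g1 : finiteThetaCoeff N k = ((k.negOnePow : ℤ) : ℤ⟦X⟧) * X ^ triangular k *
          qPochhammer (A + B) * ((1 - X ^ (A + 1)) * qPochhammerInv (A + 1)) *
          ((1 - X ^ (B + 1)) * qPochhammerInv (B + 1)) := by
        rw [finiteThetaCoeff, hAB, ← hA, ← hB, a1, b1]
      have g2 : X ^ (N + 1) * finiteThetaCoeff N (k - 1) =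
          -((k.negOnePow : ℤ) : ℤ⟦X⟧) * X ^ (triangular k + (B + 1)) *
          qPochhammer (A + B) * ((1 - X ^ A) * ((1 - X ^ (A + 1)) * qPochhammerInv (A + 1))) *
          qPochhammerInv (B + 1) := by
        rw [finiteThetaCoeff, hAB, s1, ← e1, ← a2, show (N : ℤ) + (k - 1) = A - 1 by omega,
          show (N : ℤ) + 1 - (k - 1) = B + 1 by omega]
        ring
      have g3 : X ^ (N + 1) * finiteThetaCoeff N (k + 1) =
          -((k.negOnePow : ℤ) : ℤ⟦X⟧) * X ^ (triangular k + (A + 1)) *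
          qPochhammer (A + B) * qPochhammerInv (A + 1) *
          ((1 - X ^ B) * ((1 - X ^ (B + 1)) * qPochhammerInv (B + 1))) := by
        rw [finiteThetaCoeff, hAB, s2, ← e2, ← b2, show (N : ℤ) + (k + 1) = A + 1 by omega,
          show (N : ℤ) + 1 - (k + 1) = B - 1 by omega]
        ring
      rw [mul_add, g0, g1, g2, g3, show 2 * N + 2 = A + B + 1 by omega]
      ring
    · have e1 : N + 1 + triangular (k - 1) = triangular k := by
        zify; linarith
      have i1 := qPochhammer_mul_inv (2 * N + 1)
      have i2 := qPochhammer_mul_inv (2 * (N + 1) + 1)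
      rw [finiteThetaCoeff_eq_zero (N := N) (k := k) (by omega),
        finiteThetaCoeff_eq_zero (N := N) (k := k + 1) (by omega), finiteThetaCoeff,
        finiteThetaCoeff, s1, ← e1,
        show (((N + 1 : ℕ) : ℤ)) + k = ((2 * (N + 1) + 1 : ℕ) : ℤ) by push_cast; omega,
        show (N : ℤ) + (k - 1) = ((2 * N + 1 : ℕ) : ℤ) by push_cast; omega,
        show (((N + 1 : ℕ) : ℤ)) + 1 - k = 0 by push_cast; omega,
        show (N : ℤ) + 1 - (k - 1) = 0 by omega, mul_assoc _ (qPochhammer _), i2,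
        mul_assoc _ (qPochhammer _), i1]
      ring
    · simp only [finiteThetaCoeff_eq_zero (N := N + 1) (k := k) (by push_cast; omega),
        finiteThetaCoeff_eq_zero (N := N) (k := k) (by omega),
        finiteThetaCoeff_eq_zero (N := N) (k := k + 1) (by omega),
        finiteThetaCoeff_eq_zero (N := N) (k := k - 1) (by omega), mul_zero, add_zero, sub_zero]
  · have e1 : N + 1 + triangular (k + 1) = triangular k := by
      zify; linarith
    have i1 := qPochhammer_mul_inv (2 * N + 1)
    have i2 := qPochhammer_mul_inv (2 * (N + 1) + 1)
    rw [finiteThetaCoeff_eq_zero (N := N) (k := k) (by omega),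
      finiteThetaCoeff_eq_zero (N := N) (k := k - 1) (by omega), finiteThetaCoeff,
      finiteThetaCoeff, s2, ← e1,
      show (((N + 1 : ℕ) : ℤ)) + 1 - k = ((2 * (N + 1) + 1 : ℕ) : ℤ) by push_cast; omega,
      show (N : ℤ) + 1 - (k + 1) = ((2 * N + 1 : ℕ) : ℤ) by push_cast; omega,
      show (((N + 1 : ℕ) : ℤ)) + k = 0 by push_cast; omega,
      show (N : ℤ) + (k + 1) = 0 by omega]
    linear_combination ((k.negOnePow : ℤ) : ℤ⟦X⟧) * X ^ (N + 1 + triangular (k + 1)) *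
      qPochhammerInv 0 * (i2 - i1)
  · simp only [finiteThetaCoeff_eq_zero (N := N + 1) (k := k) (by push_cast; omega),
      finiteThetaCoeff_eq_zero (N := N) (k := k) (by omega),
      finiteThetaCoeff_eq_zero (N := N) (k := k + 1) (by omega),
      finiteThetaCoeff_eq_zero (N := N) (k := k - 1) (by omega), mul_zero, add_zero, sub_zero]

theorem finite_support_mul_finiteThetaCoeff (N : ℕ) (g : ℤ → ℤ⟦X⟧) :
    (Function.support fun k => g k * finiteThetaCoeff N k).Finite := by
  refine (Set.finite_Icc (-(N : ℤ)) (N + 1)).subset fun k hk => ?_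
  by_contra h
  rw [Set.mem_Icc, not_and_or, not_le, not_le] at h
  exact hk (by simp only [finiteThetaCoeff_eq_zero h, mul_zero])

theorem finsum_mul_finiteThetaCoeff (N : ℕ) :
    ∑ᶠ k : ℤ, (k : ℤ⟦X⟧) * finiteThetaCoeff N k = -qPochhammer N ^ 2 := by
  induction N with
  | zero =>
    rw [finsum_eq_single _ 1]
    · have := qPochhammer_mul_inv 1
      have h0 := qPochhammer_mul_inv 0
      simp only [Nat.cast_one, Nat.cast_zero] at this h0
      have ht : triangular 1 = 0 := by decide
      simp [finiteThetaCoeff, this, ht]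
      simpa [qPochhammer] using h0
    · intro k hk
      obtain rfl | h := eq_or_ne k 0
      · simp
      · rw [finiteThetaCoeff_eq_zero (by push_cast; omega), mul_zero]
  | succ N ih =>
    have hsupp := finite_support_mul_finiteThetaCoeff N
    have shift1 : ∑ᶠ k : ℤ, (k : ℤ⟦X⟧) * finiteThetaCoeff N (k - 1) =
        ∑ᶠ k : ℤ, ((k : ℤ⟦X⟧) + 1) * finiteThetaCoeff N k := by
      rw [← finsum_comp_equiv (Equiv.addRight (1 : ℤ))]
      simp
    have shift2 : ∑ᶠ k : ℤ, (k : ℤ⟦X⟧) * finiteThetaCoeff N (k + 1) =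
        ∑ᶠ k : ℤ, ((k : ℤ⟦X⟧) - 1) * finiteThetaCoeff N k := by
      rw [← finsum_comp_equiv (Equiv.subRight (1 : ℤ))]
      simp
    have f1 : (Function.support fun k : ℤ => (k : ℤ⟦X⟧) * finiteThetaCoeff N (k - 1)).Finite := by
      refine (Set.finite_Icc (-(N : ℤ)) (N + 2)).subset fun k hk => ?_
      by_contra h
      rw [Set.mem_Icc, not_and_or, not_le, not_le] at h
      exact hk (by simp only [finiteThetaCoeff_eq_zero (N := N) (k := k - 1) (by omega), mul_zero])
    have f2 : (Function.support fun k : ℤ => (k : ℤ⟦X⟧) * finiteThetaCoeff N (k + 1)).Finite := by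
      refine (Set.finite_Icc (-(N : ℤ) - 1) N).subset fun k hk => ?_
      by_contra h
      rw [Set.mem_Icc, not_and_or, not_le, not_le] at h
      exact hk (by simp only [finiteThetaCoeff_eq_zero (N := N) (k := k + 1) (by omega), mul_zero])
    have hsum : ∑ᶠ k : ℤ, ((k : ℤ⟦X⟧) + 1) * finiteThetaCoeff N k +
        ∑ᶠ k : ℤ, ((k : ℤ⟦X⟧) - 1) * finiteThetaCoeff N k =
        2 * ∑ᶠ k : ℤ, (k : ℤ⟦X⟧) * finiteThetaCoeff N k := by
      rw [← finsum_add_distrib (hsupp _) (hsupp _), mul_finsum]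
      exact finsum_congr fun k => by ring
    calc ∑ᶠ k : ℤ, (k : ℤ⟦X⟧) * finiteThetaCoeff (N + 1) k
        = ∑ᶠ k : ℤ, ((1 + X ^ (2 * N + 2)) * ((k : ℤ⟦X⟧) * finiteThetaCoeff N k) -
          X ^ (N + 1) * ((k : ℤ⟦X⟧) * finiteThetaCoeff N (k - 1) +
            (k : ℤ⟦X⟧) * finiteThetaCoeff N (k + 1))) :=
          finsum_congr fun k => by rw [finiteThetaCoeff_succ]; ring
      _ = (1 + X ^ (2 * N + 2)) * ∑ᶠ k : ℤ, (k : ℤ⟦X⟧) * finiteThetaCoeff N k -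
          X ^ (N + 1) * (∑ᶠ k : ℤ, (k : ℤ⟦X⟧) * finiteThetaCoeff N (k - 1) +
            ∑ᶠ k : ℤ, (k : ℤ⟦X⟧) * finiteThetaCoeff N (k + 1)) := by
          rw [← finsum_add_distrib f1 f2, mul_finsum, mul_finsum, finsum_sub_distrib]
          · exact (hsupp _).subset (Function.support_mul_subset_right _ _)
          · exact ((f1.union f2).subset (Function.support_add _ _)).subset
              (Function.support_mul_subset_right _ _)
      _ = -qPochhammer (N + 1) ^ 2 := by
          rw [shift1, shift2, hsum, ih, qPochhammer_succ]
          ring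

theorem X_pow_dvd_qPochhammer_mul_finiteThetaCoeff_sub {N : ℕ} {k : ℤ}
    (hk : k ∈ Finset.Icc (-(N : ℤ)) (N + 1)) :
    (X : ℤ⟦X⟧) ^ (N + 1) ∣ qPochhammer N * finiteThetaCoeff N k -
      ((k.negOnePow : ℤ) : ℤ⟦X⟧) * X ^ triangular k := by
  have hone : ∀ {m : ℕ} {u v : ℤ⟦X⟧}, (X : ℤ⟦X⟧) ^ m ∣ u - 1 → (X : ℤ⟦X⟧) ^ m ∣ v - 1 →
      (X : ℤ⟦X⟧) ^ m ∣ u * v - 1 := by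
    intro m u v hu hv
    have : u * v - 1 = (u - 1) * v + (v - 1) := by ring
    rw [this]
    exact dvd_add (hu.mul_right _) hv
  rw [Finset.mem_Icc] at hk
  have tk := two_mul_triangular k
  obtain ⟨A, hA⟩ : ∃ A : ℕ, (A : ℤ) = N + k := ⟨(N + k).toNat, by omega⟩
  obtain ⟨B, hB⟩ : ∃ B : ℕ, (B : ℤ) = N + 1 - k := ⟨(N + 1 - k).toNat, by omega⟩
  obtain ⟨m, hm, hd⟩ : ∃ m : ℕ, N + 1 ≤ triangular k + m ∧ (X : ℤ⟦X⟧) ^ m ∣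
      qPochhammer N * qPochhammer (2 * N + 1) * qPochhammerInv A * qPochhammerInv B - 1 := by
    rcases le_or_gt k 0 with h | h
    · refine ⟨A + 1, by zify; nlinarith, ?_⟩
      convert hone (X_pow_dvd_qPochhammer_mul_inv_sub_one (m := A) (M := N) (by omega))
        ((pow_dvd_pow _ (by omega)).trans
          (X_pow_dvd_qPochhammer_mul_inv_sub_one (m := B) (M := 2 * N + 1) (by omega))) using 1
      ring
    · refine ⟨B + 1, by zify; nlinarith, ?_⟩
      convert hone (X_pow_dvd_qPochhammer_mul_inv_sub_one (m := B) (M := N) (by omega))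
        ((pow_dvd_pow _ (by omega)).trans
          (X_pow_dvd_qPochhammer_mul_inv_sub_one (m := A) (M := 2 * N + 1) (by omega))) using 1
      ring
  refine (pow_dvd_pow _ hm).trans ?_
  rw [pow_add]
  convert (mul_dvd_mul_left (X ^ triangular k) hd).mul_left ((k.negOnePow : ℤ) : ℤ⟦X⟧) using 1
  rw [finiteThetaCoeff, hA, hB]
  ring

/-- **Jacobi's identity** for the cube of the Euler product, coefficientwise. -/
theorem coeff_qPochhammer_pow_three {n N : ℕ} (h : n ≤ N) :
    coeff n (qPochhammer N ^ 3) = ∑ k ∈ Finset.Icc (-(N : ℤ)) (N + 1),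
      if triangular k = n then -((k.negOnePow : ℤ) * k) else 0 := by
  have hsub : (Function.support fun k : ℤ => (k : ℤ⟦X⟧) * finiteThetaCoeff N k) ⊆
      (Finset.Icc (-(N : ℤ)) (N + 1) : Set ℤ) := by
    intro k hk
    by_contra h
    rw [Finset.coe_Icc, Set.mem_Icc, not_and_or, not_le, not_le] at h
    exact hk (by simp only [finiteThetaCoeff_eq_zero h, mul_zero])
  have h3 : qPochhammer N ^ 3 = ∑ k ∈ Finset.Icc (-(N : ℤ)) (N + 1),
      ((-k : ℤ) : ℤ⟦X⟧) * (qPochhammer N * finiteThetaCoeff N k) := by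
    have := finsum_mul_finiteThetaCoeff N
    rw [finsum_eq_sum_of_support_subset _ hsub] at this
    rw [pow_succ', ← neg_neg (qPochhammer N ^ 2), ← this, mul_neg, Finset.mul_sum,
      ← Finset.sum_neg_distrib]
    exact Finset.sum_congr rfl fun k _ => by push_cast; ring
  rw [h3, map_sum]
  refine Finset.sum_congr rfl fun k hk => ?_
  have hc := (X_pow_dvd_iff.mp (X_pow_dvd_qPochhammer_mul_finiteThetaCoeff_sub hk)) n (by omega)
  rw [map_sub, sub_eq_zero] at hc
  rw [← eq_intCast (C : ℤ →+* ℤ⟦X⟧), coeff_C_mul, hc,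
    ← eq_intCast (C : ℤ →+* ℤ⟦X⟧), coeff_C_mul, coeff_X_pow]
  simp only [eq_comm (a := n)]
  split_ifs <;> simp [mul_comm]

end Jacobi

section EulerProduct

open PowerSeries

theorem coeff_qPochhammer_eq_coeff_pentagonalSeries {n N : ℕ} (h : n ≤ N) :
    coeff n (qPochhammer N) = coeff n (pentagonalSeries ℤ) := by
  obtain ⟨s, hs⟩ := Filter.eventually_atTop.mp (coeff_prod_one_sub_X_pow_eventually_eq ℤ n)
  obtain ⟨M, hM⟩ := s.exists_nat_subset_range
  rw [← hs (Finset.range (max M N)) (hM.trans (Finset.range_mono (le_max_left _ _)))]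
  have := X_pow_dvd_iff.mp (X_pow_dvd_qPochhammer_sub (le_max_right M N)) n (by omega)
  rw [map_sub, sub_eq_zero] at this
  exact this.symm

theorem coeff_qPochhammer {n N : ℕ} (h : n ≤ N) :
    coeff n (qPochhammer N) = ∑ k ∈ Finset.Icc (-(N : ℤ)) (N + 1),
      if pentagonal k = n then (k.negOnePow : ℤ) else 0 := by
  rw [coeff_qPochhammer_eq_coeff_pentagonalSeries h]
  by_cases hn : n ∈ Set.range pentagonal
  · obtain ⟨k, rfl⟩ := hn
    have hk := two_mul_natCast_pentagonal k
    have hmem : k ∈ Finset.Icc (-(N : ℤ)) (N + 1) := by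
      rw [Finset.mem_Icc]
      constructor <;> nlinarith
    simp only [pentagonal_inj]
    rw [Finset.sum_ite_eq' _ k, if_pos hmem, coeff_pentagonalSeries_pentagonal]
    rfl
  · rw [coeff_pentagonalSeries_eq_zero ℤ hn, Finset.sum_eq_zero]
    intro k _
    exact if_neg fun hk => hn ⟨k, hk⟩

/-- The index set of the expansion of the fourth power of the Euler product. -/
noncomputable def pentagonalTriangularReps (n : ℕ) : Finset (ℤ × ℤ) :=
  (Finset.Icc (-(n : ℤ)) (n + 1) ×ˢ Finset.Icc (-(n : ℤ)) (n + 1)).filter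
    fun z => pentagonal z.1 + triangular z.2 = n

theorem mem_pentagonalTriangularReps {n : ℕ} {z : ℤ × ℤ} :
    z ∈ pentagonalTriangularReps n ↔ pentagonal z.1 + triangular z.2 = n := by
  simp only [pentagonalTriangularReps, Finset.mem_filter, Finset.mem_product, Finset.mem_Icc,
    and_iff_right_iff_imp]
  intro h
  have h1 := two_mul_natCast_pentagonal z.1
  have h2 := two_mul_triangular z.2
  have hp : (pentagonal z.1 : ℤ) ≤ n := by omega
  have ht : (triangular z.2 : ℤ) ≤ n := by omega
  refine ⟨⟨?_, ?_⟩, ?_, ?_⟩ <;> nlinarith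

theorem coeff_qPochhammer_pow_four (n : ℕ) :
    coeff n (qPochhammer n ^ 4) = ∑ z ∈ pentagonalTriangularReps n,
      -((z.1.negOnePow : ℤ) * (z.2.negOnePow : ℤ) * z.2) := by
  rw [pow_succ', coeff_mul]
  have : ∀ x ∈ Finset.HasAntidiagonal.antidiagonal n,
      coeff x.1 (qPochhammer n) * coeff x.2 (qPochhammer n ^ 3) =
      ∑ z ∈ Finset.Icc (-(n : ℤ)) (n + 1) ×ˢ Finset.Icc (-(n : ℤ)) (n + 1),
        if x = (pentagonal z.1, triangular z.2) then
          -((z.1.negOnePow : ℤ) * (z.2.negOnePow : ℤ) * z.2) else 0 := by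
    intro x hx
    rw [Finset.HasAntidiagonal.mem_antidiagonal] at hx
    rw [coeff_qPochhammer (by omega), coeff_qPochhammer_pow_three (by omega),
      Finset.sum_mul_sum, Finset.sum_product]
    refine Finset.sum_congr rfl fun k _ => Finset.sum_congr rfl fun l _ => ?_
    by_cases hk : pentagonal k = x.1 <;> by_cases hl : triangular l = x.2 <;>
      simp [hk, hl, Prod.ext_iff, eq_comm (a := x.1), eq_comm (a := x.2), mul_assoc]
  rw [Finset.sum_congr rfl this, Finset.sum_comm, pentagonalTriangularReps, Finset.sum_filter]
  refine Finset.sum_congr rfl fun z _ => ?_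
  rw [Finset.sum_ite_eq' (Finset.HasAntidiagonal.antidiagonal n)]
  simp only [Finset.HasAntidiagonal.mem_antidiagonal]

theorem sum_pentagonalTriangularReps (n : ℕ) :
    ∑ z ∈ pentagonalTriangularReps n, -((z.1.negOnePow : ℤ) * (z.2.negOnePow : ℤ) * z.2) =
      ∑ z ∈ pentagonalTriangularReps n with Odd (z.1 + z.2), (2 * z.2 - 1) := by
  rw [← Finset.sum_filter_add_sum_filter_not _ (fun z : ℤ × ℤ => Odd (z.1 + z.2))]
  have hodd : ∑ z ∈ pentagonalTriangularReps n with Odd (z.1 + z.2),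
      -((z.1.negOnePow : ℤ) * (z.2.negOnePow : ℤ) * z.2) =
      ∑ z ∈ pentagonalTriangularReps n with Odd (z.1 + z.2), z.2 := by
    refine Finset.sum_congr rfl fun z hz => ?_
    have := Int.negOnePow_odd _ (Finset.mem_filter.mp hz).2
    rw [← Units.val_mul, ← Int.negOnePow_add, this]
    simp
  have heven : ∑ z ∈ pentagonalTriangularReps n with ¬ Odd (z.1 + z.2),
      -((z.1.negOnePow : ℤ) * (z.2.negOnePow : ℤ) * z.2) =
      ∑ z ∈ pentagonalTriangularReps n with Odd (z.1 + z.2), (z.2 - 1) := by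
    have ht : ∀ l, triangular (1 - l) = triangular l := fun l => by
      have h1 := two_mul_triangular l
      have h2 := two_mul_triangular (1 - l)
      zify
      linarith
    refine Finset.sum_nbij' (fun z => (z.1, 1 - z.2)) (fun z => (z.1, 1 - z.2)) ?_ ?_ ?_ ?_ ?_
    · intro z hz
      simp only [Finset.mem_filter, mem_pentagonalTriangularReps, ht] at hz ⊢
      exact ⟨hz.1, by grind⟩
    · intro z hz
      simp only [Finset.mem_filter, mem_pentagonalTriangularReps, ht] at hz ⊢
      exact ⟨hz.1, by grind⟩
    · simp
    · simp
    · intro z hz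
      have := Int.negOnePow_even _ (Int.not_odd_iff_even.mp (Finset.mem_filter.mp hz).2)
      rw [← Units.val_mul, ← Int.negOnePow_add, this]
      simp
  rw [hodd, heven, ← Finset.sum_add_distrib]
  exact Finset.sum_congr rfl fun z _ => by ring

theorem coeff_qPochhammer_pow_four_eq_heckeCoeff (n : ℕ) :
    coeff n (qPochhammer n ^ 4) = heckeCoeff (6 * n + 1) := by
  have hF : heckeCoeff (6 * n + 1) = ∑ z ∈ primaryReps (6 * n + 1), (z.1 - z.2) := by
    rw [Finset.sum_sub_distrib, sum_snd_primaryReps, sub_zero, heckeCoeff]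
  rw [coeff_qPochhammer_pow_four, sum_pentagonalTriangularReps, hF]
  refine Finset.sum_nbij'
    (fun z => ((3 * (z.2 - z.1) - 1) / 2, -((3 * z.1 + z.2 - 1) / 2)))
    (fun w => ((1 - w.1 - 3 * w.2) / 6, (w.1 - w.2 + 1) / 2)) ?_ ?_ ?_ ?_ ?_
  · rintro ⟨k, l⟩ hz
    simp only [Finset.mem_filter, mem_pentagonalTriangularReps] at hz
    obtain ⟨h, j, hj⟩ := hz
    have h1 := two_mul_natCast_pentagonal k
    have h2 := two_mul_triangular l
    obtain rfl : l = 2 * j + 1 - k := by omega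
    rw [mem_primaryReps]
    simp only
    rw [show (3 * (2 * j + 1 - k - k) - 1) / 2 = 3 * j - 3 * k + 1 by omega,
      show (3 * k + (2 * j + 1 - k) - 1) / 2 = k + j by omega]
    refine ⟨?_, by omega⟩
    push_cast [← h]
    linarith
  · rintro ⟨x, y⟩ hw
    obtain ⟨h1, h2⟩ := mem_primaryReps.mp hw
    simp only at h1 h2
    push_cast at h1
    obtain ⟨i, rfl⟩ : ∃ i, x = 3 * i + 1 := ⟨x / 3, by omega⟩
    obtain ⟨j, hj⟩ : ∃ j, i + y = 2 * j := by
      have : Even (i + y) := by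
        by_contra ho
        obtain ⟨j, hj⟩ := Int.not_even_iff_odd.mp ho
        obtain rfl : y = 2 * j + 1 - i := by omega
        ring_nf at h1
        omega
      exact this.two_dvd
    obtain rfl : y = 2 * j - i := by omega
    simp only [Finset.mem_filter, mem_pentagonalTriangularReps]
    rw [show (1 - (3 * i + 1) - 3 * (2 * j - i)) / 6 = -j by omega,
      show (3 * i + 1 - (2 * j - i) + 1) / 2 = 2 * i - j + 1 by omega]
    refine ⟨?_, i - j, by ring⟩
    have h3 := two_mul_natCast_pentagonal (-j)
    have h4 := two_mul_triangular (2 * i - j + 1)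
    zify
    linarith
  · rintro ⟨k, l⟩ hz
    obtain ⟨j, hj⟩ := (Finset.mem_filter.mp hz).2
    simp only [Prod.mk.injEq] at hj ⊢
    omega
  · rintro ⟨x, y⟩ hw
    obtain ⟨h1, h2⟩ := mem_primaryReps.mp hw
    simp only at h1 h2
    push_cast at h1
    obtain ⟨i, rfl⟩ : ∃ i, x = 3 * i + 1 := ⟨x / 3, by omega⟩
    have : Even (i + y) := by
      by_contra ho
      obtain ⟨j, hj⟩ := Int.not_even_iff_odd.mp ho
      obtain rfl : y = 2 * j + 1 - i := by omega
      ring_nf at h1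
      omega
    obtain ⟨j, hj⟩ := this
    simp only [Prod.mk.injEq]
    omega
  · rintro ⟨k, l⟩ hz
    obtain ⟨j, hj⟩ := (Finset.mem_filter.mp hz).2
    simp only at hj ⊢
    omega

theorem coeff_prod_one_sub_X_pow_pow_four (n : ℕ) :
    ((∏ m ∈ Finset.Icc 1 n, ((1 : Polynomial ℤ) - Polynomial.X ^ m)) ^ 4).coeff n =
      heckeCoeff (6 * n + 1) := by
  have hcoe : (((∏ m ∈ Finset.Icc 1 n, ((1 : Polynomial ℤ) - Polynomial.X ^ m) : Polynomial ℤ)) :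
      ℤ⟦X⟧) = qPochhammer n := by
    rw [qPochhammer, ← Finset.Ico_add_one_right_eq_Icc, Finset.prod_Ico_eq_prod_range,
      ← Polynomial.coeToPowerSeries.ringHom_apply, map_prod]
    refine Finset.prod_congr rfl fun i _ => ?_
    simp [add_comm]
  rw [← coeff_qPochhammer_pow_four_eq_heckeCoeff, ← Polynomial.coeff_coe, Polynomial.coe_pow, hcoe]

end EulerProduct

/-- With `a n` the coefficient of `q^n` in `∏ (1 - q^m)^4`, and `f` the
multiplicative function with the stated values on prime powers (involving the
representation `p = x² + 3y²` for `p ≡ 1 (mod 6)`), we have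
`a n = f (6 n + 1)` for all `n`; moreover the representing pair is unique. -/
theorem stmt_12 (a : ℕ → ℤ)
    (ha : ∀ n N : ℕ, n ≤ N →
      a n = (((∏ m ∈ Finset.Icc 1 N, ((1 : Polynomial ℤ) - Polynomial.X ^ m)) ^ 4).coeff n))
    (f : ℕ → ℤ)
    (hf1 : f 1 = 1)
    (hfmul : ∀ m n : ℕ, Nat.Coprime m n → f (m * n) = f m * f n)
    (hfa : ∀ p r : ℕ, p.Prime → 1 ≤ r → p % 6 = 5 → Even r →
      f (p ^ r) = (-1) ^ (r / 2) * (p : ℤ) ^ (r / 2))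
    (hfb : ∀ p r x y : ℕ, p.Prime → 1 ≤ r → p % 6 = 1 → 0 < x → 0 < y →
      p = x ^ 2 + 3 * y ^ 2 →
      (f (p ^ r) : ℂ) =
        (if Odd r ∧ x % 3 ≠ 1 then (-1 : ℂ) else 1) *
          (((x : ℂ) + Real.sqrt 3 * Complex.I * y) ^ (r + 1) -
            ((x : ℂ) - Real.sqrt 3 * Complex.I * y) ^ (r + 1)) /
          (2 * Real.sqrt 3 * Complex.I * y))
    (hf0 : ∀ p r : ℕ, p.Prime → 1 ≤ r → ¬(p % 6 = 1) → ¬(p % 6 = 5 ∧ Even r) →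
      f (p ^ r) = 0) :
    (∀ p : ℕ, p.Prime → p % 6 = 1 →
      ∃! xy : ℕ × ℕ, 0 < xy.1 ∧ 0 < xy.2 ∧ p = xy.1 ^ 2 + 3 * xy.2 ^ 2) ∧
    ∀ n : ℕ, a n = f (6 * n + 1) := by
  refine ⟨fun p hp hp1 => ?_, fun n => ?_⟩
  · obtain ⟨x, y, hx, hy, hxy⟩ := exists_prime_eq_sq_add_three_mul_sq hp hp1
    refine ⟨(x, y), ⟨hx, hy, hxy⟩, ?_⟩
    rintro ⟨u, v⟩ ⟨hu, hv, huv⟩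
    obtain ⟨rfl, rfl⟩ := prime_eq_sq_add_three_mul_sq_unique hp hx hy hu hv hxy huv
    rfl
  · have hcop : (6 * n + 1).Coprime 6 := by simp
    rw [ha n n le_rfl, coeff_prod_one_sub_X_pow_pow_four,
      eq_heckeCoeff f hf1 hfmul hfa hfb hf0 _ hcop]
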